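/- arXiv:1601.03787 — 6 statements merged into one kernel-verified Lean document; each statement's English description precedes it below -/
import Mathlib

section
/- Let M be an n×n complex matrix that is c-stable, i.e., every eigenvalue of M has negative real part. Then the linear operator L on the space of n×n complex matrices defined by L(W) = Mᴴ W + W M is bijective. -/
open Matrix

/-- A matrix intertwining `A` and `B` intertwines every polynomial in them. -/
theorem Matrix.aeval_mul_eq_mul_aeval {R m n : Type*} [CommRing R] [Fintype m] [DecidableEq m]
    [Fintype n] [DecidableEq n] {A : Matrix m m R} {B : Matrix n n R} {W : Matrix m n R}
    (h : A * W = W * B) (p : Polynomial R) :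
    Polynomial.aeval A p * W = W * Polynomial.aeval B p := by
  induction p using Polynomial.induction_on' with
  | add p q hp hq => simp only [map_add, Matrix.add_mul, Matrix.mul_add, hp, hq]
  | monomial k a =>
    have hpow : A ^ k * W = W * B ^ k := by
      induction k with
      | zero => simp
      | succ k ih => rw [pow_succ, pow_succ, Matrix.mul_assoc, h, ← Matrix.mul_assoc, ih,
          Matrix.mul_assoc]
    simp only [Polynomial.aeval_monomial, Algebra.algebraMap_eq_smul_one, smul_mul_assoc, one_mul,
      Matrix.smul_mul, Matrix.mul_smul, hpow]

/-- The homogeneous Sylvester equation has only the zero solution when the spectra are disjoint. -/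
theorem Matrix.eq_zero_of_mul_eq_mul_of_disjoint_spectrum {K m n : Type*} [Field K] [IsAlgClosed K]
    [Fintype m] [DecidableEq m] [Fintype n] [DecidableEq n]
    {A : Matrix m m K} {B : Matrix n n K} {W : Matrix m n K}
    (hAB : Disjoint (spectrum K A) (spectrum K B)) (h : A * W = W * B) : W = 0 := by
  have hcop : IsCoprime A.charpoly B.charpoly := by
    rw [Polynomial.isCoprime_iff_aeval_ne_zero_of_isAlgClosed K K]
    intro a
    by_contra! ha
    simp only [Polynomial.coe_aeval_eq_eval] at ha
    exact Set.disjoint_left.mp hAB (mem_spectrum_iff_isRoot_charpoly.mpr ha.1)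
      (mem_spectrum_iff_isRoot_charpoly.mpr ha.2)
  obtain ⟨u, v, huv⟩ := hcop
  have hone : Polynomial.aeval B A.charpoly * Polynomial.aeval B u = 1 := by
    simpa [aeval_self_charpoly, mul_comm u] using congrArg (Polynomial.aeval B) huv
  have hzero : W * Polynomial.aeval B A.charpoly = 0 := by
    rw [← aeval_mul_eq_mul_aeval h, aeval_self_charpoly, Matrix.zero_mul]
  rw [← Matrix.mul_one W, ← hone, ← Matrix.mul_assoc, hzero, Matrix.zero_mul]

/-- If `M` is c-stable (every eigenvalue has negative real part), then the Lyapunov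
operator `W ↦ Mᴴ W + W M` on `n × n` complex matrices is bijective. -/
theorem lyapunov_operator_bijective_of_cStable (n : ℕ) (M : Matrix (Fin n) (Fin n) ℂ)
    (hM : ∀ μ ∈ spectrum ℂ M, μ.re < 0) :
    Function.Bijective (fun W : Matrix (Fin n) (Fin n) ℂ => Mᴴ * W + W * M) := by
  have hdisj : Disjoint (spectrum ℂ Mᴴ) (spectrum ℂ (-M)) := by
    rw [Set.disjoint_left]
    intro μ hμ hμ'
    rw [← star_eq_conjTranspose, spectrum.map_star, Set.mem_star] at hμ
    rw [← spectrum.neg_eq, Set.mem_neg] at hμ'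
    have h₁ : μ.re < 0 := by simpa using hM _ hμ
    have h₂ : 0 < μ.re := by simpa using hM _ hμ'
    exact lt_asymm h₁ h₂
  let L : Matrix (Fin n) (Fin n) ℂ →ₗ[ℂ] Matrix (Fin n) (Fin n) ℂ :=
    LinearMap.mulLeft ℂ Mᴴ + LinearMap.mulRight ℂ M
  have hinj : Function.Injective L := by
    refine (injective_iff_map_eq_zero L).mpr fun W hW => ?_
    refine eq_zero_of_mul_eq_mul_of_disjoint_spectrum hdisj ?_
    rw [Matrix.mul_neg]
    exact eq_neg_of_add_eq_zero_left hW
  exact ⟨hinj, LinearMap.injective_iff_surjective.mp hinj⟩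
end

section
/- Let M be an n×n complex matrix that is c-stable, i.e., every eigenvalue of M has negative real part, and let C be an n×n Hermitian matrix. Then there exists a unique n×n complex matrix W satisfying Mᴴ W + W M = C, and this W is Hermitian. -/
open Matrix

namespace Matrix

open Polynomial

variable {m n K : Type*} [Fintype m] [DecidableEq m] [Fintype n] [DecidableEq n]

/-- If `X` intertwines `A` and `B`, then it intertwines `p(A)` and `p(B)` for every
polynomial `p`. -/
theorem aeval_mul_eq_mul_aeval_s1 {R : Type*} [CommRing R] {A : Matrix m m R} {B : Matrix n n R}
    {X : Matrix m n R} (h : A * X = X * B) (p : R[X]) : aeval A p * X = X * aeval B p := by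
  induction p using Polynomial.induction_on with
  | C a => simp [Algebra.algebraMap_eq_smul_one]
  | add p q hp hq => simp [Matrix.add_mul, Matrix.mul_add, hp, hq]
  | monomial k a ih =>
    rw [pow_succ, ← mul_assoc, map_mul (aeval A) (_ * _), map_mul (aeval B) (_ * _), aeval_X,
      aeval_X, Matrix.mul_assoc, h, ← Matrix.mul_assoc, ih, Matrix.mul_assoc]

/-- A matrix intertwining two matrices with disjoint spectra is zero. -/
theorem eq_zero_of_mul_eq_mul_of_disjoint_spectrum_s1 [Field K] [IsAlgClosed K]
    {A : Matrix m m K} {B : Matrix n n K} {X : Matrix m n K}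
    (hAB : Disjoint (spectrum K A) (spectrum K B)) (h : A * X = X * B) : X = 0 := by
  cases isEmpty_or_nonempty m
  · exact Subsingleton.elim _ _
  have hunit : IsUnit (aeval A B.charpoly) := by
    rw [← spectrum.zero_notMem_iff K, spectrum.map_polynomial_aeval_of_nonempty A _
      (spectrum.nonempty_of_isAlgClosed_of_finiteDimensional K A)]
    rintro ⟨μ, hμ, h0⟩
    exact Set.disjoint_left.mp hAB hμ (mem_spectrum_iff_isRoot_charpoly.mpr h0)
  have hX : aeval A B.charpoly * X = 0 := by
    rw [aeval_mul_eq_mul_aeval_s1 h, aeval_self_charpoly, Matrix.mul_zero]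
  obtain ⟨u, hu⟩ := hunit
  calc X = (↑u⁻¹ * ↑u : Matrix m m K) * X := by simp
    _ = 0 := by rw [Matrix.mul_assoc, hu, hX, Matrix.mul_zero]

/-- The Sylvester equation `A X - X B = C` has a unique solution when `A` and `B` have disjoint
spectra. -/
theorem existsUnique_mul_sub_mul_eq [Field K] [IsAlgClosed K] {A : Matrix m m K}
    {B : Matrix n n K} (hAB : Disjoint (spectrum K A) (spectrum K B)) (C : Matrix m n K) :
    ∃! X : Matrix m n K, A * X - X * B = C := by
  let L : Matrix m n K →ₗ[K] Matrix m n K := mulLeftLinearMap n K A - mulRightLinearMap m K B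
  have hL : Function.Injective L := (injective_iff_map_eq_zero L).mpr fun X hX =>
    eq_zero_of_mul_eq_mul_of_disjoint_spectrum_s1 hAB (sub_eq_zero.mp hX)
  exact Function.Bijective.existsUnique ⟨hL, LinearMap.injective_iff_surjective.mp hL⟩ C

end Matrix

/-- If `M` is c-stable and `C` is Hermitian, then the continuous Lyapunov equation
`Mᴴ W + W M = C` has a unique solution `W`, and this solution is Hermitian. -/
theorem lyapunov_existsUnique_isHermitian (n : ℕ) (M C : Matrix (Fin n) (Fin n) ℂ)
    (hM : ∀ μ ∈ spectrum ℂ M, μ.re < 0) (hC : C.IsHermitian) :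
    (∃! W : Matrix (Fin n) (Fin n) ℂ, Mᴴ * W + W * M = C) ∧
      ∀ W : Matrix (Fin n) (Fin n) ℂ, Mᴴ * W + W * M = C → W.IsHermitian := by
  have hdisj : Disjoint (spectrum ℂ Mᴴ) (spectrum ℂ (-M)) := by
    rw [Set.disjoint_left]
    intro μ hμ hμ'
    rw [← star_eq_conjTranspose, spectrum.map_star, Set.mem_star] at hμ
    rw [← spectrum.neg_eq, Set.mem_neg] at hμ'
    have h₁ := hM _ hμ
    have h₂ := hM _ hμ'
    simp only [Complex.star_def, Complex.conj_re, Complex.neg_re] at h₁ h₂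
    linarith
  have hex : ∃! W : Matrix (Fin n) (Fin n) ℂ, Mᴴ * W + W * M = C := by
    simpa using existsUnique_mul_sub_mul_eq hdisj C
  refine ⟨hex, fun W hW => hex.unique ?_ hW⟩
  simpa [hC.eq, add_comm] using congrArg conjTranspose hW
end

section
/- Let A, ΔA, G, ΔG, Q, ΔQ, Y, Ỹ be n×n complex matrices with G and Y Hermitian. Set Ã = A + ΔA, G̃ = G + ΔG, Q̃ = Q + ΔQ, and suppose I + G Y and I + G̃ Ỹ are invertible, with W = (I + G Y)⁻¹ and W̃ = (I + G̃ Ỹ)⁻¹. Suppose Y satisfies the discrete-time algebraic Riccati equation Y = Aᴴ Y W A + Q and Ỹ satisfies Ỹ = Ãᴴ Ỹ W̃ Ã + Q̃. Then ΔY := Ỹ − Y satisfies the exact identity ΔY − (W A)ᴴ ΔY (W̃ A) = ΔQ + ΔAᴴ Ỹ W̃ Ã + Aᴴ Ỹ W̃ ΔA − Aᴴ Y W ΔG Ỹ W̃ A. -/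
open Matrix

/-- The difference `Y' W' - Y W` for `W = (1 + G Y)⁻¹`, `W' = (1 + G' Y')⁻¹`, where `V` is a left
inverse of `1 + Y G`. -/
theorem mul_sub_mul_eq_of_inverses {R : Type*} [Ring R] {G ΔG Y Y' V W W' : R}
    (hV : V * (1 + Y * G) = 1) (hW : (1 + G * Y) * W = 1)
    (hW' : (1 + (G + ΔG) * Y') * W' = 1) :
    Y' * W' - Y * W = V * (Y' - Y) * W' - Y * W * ΔG * Y' * W' := by
  have hVY : Y * W = V * Y :=
    calc Y * W = V * (1 + Y * G) * (Y * W) := by rw [hV, one_mul]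
      _ = V * Y * ((1 + G * Y) * W) := by noncomm_ring
      _ = V * Y := by rw [hW, mul_one]
  calc Y' * W' - Y * W
      = V * (1 + Y * G) * (Y' * W') - V * Y * ((1 + (G + ΔG) * Y') * W') := by
        rw [hV, hW', one_mul, mul_one, hVY]
    _ = V * (Y' - Y) * W' - V * Y * ΔG * Y' * W' := by noncomm_ring
    _ = V * (Y' - Y) * W' - Y * W * ΔG * Y' * W' := by rw [hVY]

/-- Exact perturbation identity for the discrete-time algebraic Riccati equation:
if `Y` solves the DARE `Y = Aᴴ Y W A + Q` with `W = (I + GY)⁻¹`, and `Ỹ` solves the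
perturbed DARE with `W̃ = (I + G̃ Ỹ)⁻¹`, then `ΔY = Ỹ − Y` satisfies
`ΔY − (WA)ᴴ ΔY (W̃A) = ΔQ + ΔAᴴ Ỹ W̃ Ã + Aᴴ Ỹ W̃ ΔA − Aᴴ Y W ΔG Ỹ W̃ A`. -/
theorem dare_exact_perturbation_identity (n : ℕ)
    (A ΔA G ΔG Q ΔQ Y Y' : Matrix (Fin n) (Fin n) ℂ)
    (hG : G.IsHermitian) (hY : Y.IsHermitian)
    (h1 : IsUnit (1 + G * Y)) (h2 : IsUnit (1 + (G + ΔG) * Y'))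
    (hYeq : Y = Aᴴ * Y * (1 + G * Y)⁻¹ * A + Q)
    (hY'eq : Y' = (A + ΔA)ᴴ * Y' * (1 + (G + ΔG) * Y')⁻¹ * (A + ΔA) + (Q + ΔQ)) :
    (Y' - Y) - ((1 + G * Y)⁻¹ * A)ᴴ * (Y' - Y) * ((1 + (G + ΔG) * Y')⁻¹ * A) =
      ΔQ + ΔAᴴ * Y' * (1 + (G + ΔG) * Y')⁻¹ * (A + ΔA)
        + Aᴴ * Y' * (1 + (G + ΔG) * Y')⁻¹ * ΔA
        - Aᴴ * Y * (1 + G * Y)⁻¹ * ΔG * Y' * (1 + (G + ΔG) * Y')⁻¹ * A := by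
  have hW := mul_nonsing_inv _ ((isUnit_iff_isUnit_det _).mp h1)
  have hW' := mul_nonsing_inv _ ((isUnit_iff_isUnit_det _).mp h2)
  have hV : (1 + G * Y)⁻¹ᴴ * (1 + Y * G) = 1 := by
    have h := congrArg conjTranspose hW
    rwa [conjTranspose_mul, conjTranspose_add, conjTranspose_mul, conjTranspose_one,
      hG.eq, hY.eq] at h
  have key := mul_sub_mul_eq_of_inverses hV hW hW'
  rw [conjTranspose_mul]
  rw [conjTranspose_add] at hY'eq
  generalize (1 + G * Y)⁻¹ᴴ = V at *
  generalize (1 + G * Y)⁻¹ = W at *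
  generalize (1 + (G + ΔG) * Y')⁻¹ = W' at *
  have hΔ : Y' - Y = (Aᴴ + ΔAᴴ) * Y' * W' * (A + ΔA) + (Q + ΔQ) - (Aᴴ * Y * W * A + Q) := by
    rw [← hY'eq, ← hYeq]
  have hA : Aᴴ * V * (Y' - Y) * (W' * A) =
      Aᴴ * (Y' * W' - Y * W + Y * W * ΔG * Y' * W') * A := by
    rw [key]; noncomm_ring
  rw [hA, hΔ]
  noncomm_ring
end

section
/- Let K be a real m×p matrix and d a real p-vector. Then the supremum of ‖K x‖_∞ over all real p-vectors x satisfying |xᵢ| ≤ |dᵢ| for every i equals ‖ |K| |d| ‖_∞, where |K| is the matrix of entrywise absolute values of K and |d| the vector of entrywise absolute values of d; moreover this supremum is attained by some x with |xᵢ| = |dᵢ| for all i. -/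
open Matrix

/-- Entrywise triangle inequality for a matrix-vector product. -/
theorem Matrix.abs_mulVec_le {ι κ : Type*} [Fintype κ] (K : Matrix ι κ ℝ) {x d : κ → ℝ}
    (hx : ∀ i, |x i| ≤ |d i|) (j : ι) :
    |K.mulVec x j| ≤ (K.map fun a => |a|).mulVec (fun i => |d i|) j := by
  simp only [mulVec, dotProduct, map_apply]
  refine (Finset.abs_sum_le_sum_abs _ _).trans (Finset.sum_le_sum fun i _ => ?_)
  rw [abs_mul]
  exact mul_le_mul_of_nonneg_left (hx i) (abs_nonneg _)

/-- The entrywise bound is attained in any prescribed row by a choice of signs. -/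
theorem Matrix.exists_abs_eq_mulVec_eq {ι κ : Type*} [Fintype κ] (K : Matrix ι κ ℝ)
    (d : κ → ℝ) (j : ι) :
    ∃ x : κ → ℝ, (∀ i, |x i| = |d i|) ∧
      K.mulVec x j = (K.map fun a => |a|).mulVec (fun i => |d i|) j := by
  refine ⟨fun i => if 0 ≤ K j i then |d i| else -|d i|, fun i => ?_, ?_⟩
  · dsimp only
    split_ifs <;> simp
  · simp only [mulVec, dotProduct, map_apply]
    refine Finset.sum_congr rfl fun i _ => ?_
    split_ifs with h
    · rw [abs_of_nonneg h]
    · rw [abs_of_neg (not_le.mp h)]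
      ring

/-- For a real `m × p` matrix `K` and a real vector `d`, the supremum of `‖K x‖_∞` over
all `x` with `|xᵢ| ≤ |dᵢ|` for every `i` equals `‖ |K| |d| ‖_∞` (entrywise absolute
values), and it is attained by some `x` with `|xᵢ| = |dᵢ|` for all `i`.
Here the norm on `Fin m → ℝ` is the sup (ℓ∞) norm. -/
theorem mulVec_sup_norm_componentwise_bound (m p : ℕ)
    (K : Matrix (Fin m) (Fin p) ℝ) (d : Fin p → ℝ) :
    (∀ x : Fin p → ℝ, (∀ i, |x i| ≤ |d i|) →
        ‖K.mulVec x‖ ≤ ‖(K.map fun a => |a|).mulVec fun i => |d i|‖) ∧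
      ∃ x : Fin p → ℝ, (∀ i, |x i| = |d i|) ∧
        ‖K.mulVec x‖ = ‖(K.map fun a => |a|).mulVec fun i => |d i|‖ := by
  have bound : ∀ x : Fin p → ℝ, (∀ i, |x i| ≤ |d i|) →
      ‖K.mulVec x‖ ≤ ‖(K.map fun a => |a|).mulVec fun i => |d i|‖ := fun x hx =>
    (pi_norm_le_iff_of_nonneg (norm_nonneg _)).2 fun j =>
      ((K.abs_mulVec_le hx j).trans (le_abs_self _)).trans
        (norm_le_pi_norm ((K.map fun a => |a|).mulVec fun i => |d i|) j)
  refine ⟨bound, ?_⟩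
  rcases isEmpty_or_nonempty (Fin m) with _ | _
  · exact ⟨d, fun _ => rfl, congrArg _ (Subsingleton.elim _ _)⟩
  · obtain ⟨j, hj⟩ := Finite.exists_max
      fun j => ‖(K.map fun a => |a|).mulVec (fun i => |d i|) j‖
    obtain ⟨x, hx, hxj⟩ := K.exists_abs_eq_mulVec_eq d j
    refine ⟨x, hx, (bound x fun i => (hx i).le).antisymm ?_⟩
    refine (pi_norm_le_iff_of_nonneg (norm_nonneg _)).2 fun k => (hj k).trans ?_
    rw [← hxj]
    exact norm_le_pi_norm _ j
end

section
/- Let M be an n×n complex matrix that is c-stable, i.e., every eigenvalue of M has negative real part. Then the n²×n² matrix Z = Iₙ ⊗ Mᴴ + Mᵀ ⊗ Iₙ is invertible, where ⊗ denotes the Kronecker product. -/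
open Matrix
open scoped Kronecker

/-- If `A * X = X * B`, then `X` also intertwines `p(A)` and `p(B)` for every polynomial `p`. -/
theorem SemiconjBy.polynomial_aeval {R S : Type*} [CommSemiring R] [Semiring S] [Algebra R S]
    {X A B : S} (h : SemiconjBy X B A) (p : Polynomial R) :
    SemiconjBy X (Polynomial.aeval B p) (Polynomial.aeval A p) := by
  induction p using Polynomial.induction_on' with
  | add p q hp hq => simpa using hp.add_right hq
  | monomial k a =>
    simpa only [Polynomial.aeval_monomial] using
      SemiconjBy.mul_right (Algebra.commutes a X).symm (h.pow_right k)

/-- The homogeneous Sylvester equation `X * B = A * X` has only the trivial solution when `A` and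
`B` have no common eigenvalue. -/
theorem Matrix.eq_zero_of_semiconjBy_of_disjoint_spectrum {K n : Type*} [Field K] [IsAlgClosed K]
    [Fintype n] [DecidableEq n] {A B X : Matrix n n K} (h : SemiconjBy X B A)
    (hAB : Disjoint (spectrum K A) (spectrum K B)) : X = 0 := by
  cases isEmpty_or_nonempty n with
  | inl _ => exact Subsingleton.elim _ _
  | inr _ =>
    have hunit : IsUnit (Polynomial.aeval B A.charpoly) := by
      rw [← spectrum.zero_notMem_iff K,
        spectrum.map_polynomial_aeval_of_nonempty _ _
          (spectrum.nonempty_of_isAlgClosed_of_finiteDimensional K B)]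
      rintro ⟨μ, hμ, hroot⟩
      exact Set.disjoint_left.mp hAB (mem_spectrum_iff_isRoot_charpoly.mpr hroot) hμ
    have hX := (h.polynomial_aeval A.charpoly).eq
    rw [aeval_self_charpoly, zero_mul] at hX
    exact hunit.mul_left_eq_zero.mp hX

/-- If `M` is c-stable, then the Kronecker matrix representation
`Z = Iₙ ⊗ Mᴴ + Mᵀ ⊗ Iₙ` of the Lyapunov operator is invertible. -/
theorem lyapunov_kronecker_isUnit_of_cStable (n : ℕ) (M : Matrix (Fin n) (Fin n) ℂ)
    (hM : ∀ μ ∈ spectrum ℂ M, μ.re < 0) :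
    IsUnit ((1 : Matrix (Fin n) (Fin n) ℂ) ⊗ₖ Mᴴ +
      Mᵀ ⊗ₖ (1 : Matrix (Fin n) (Fin n) ℂ)) := by
  rw [← mulVec_injective_iff_isUnit, ← coe_mulVecLin, injective_iff_map_eq_zero]
  intro v hv
  obtain ⟨X, rfl⟩ := vec_bijective.surjective v
  rw [mulVecLin_apply, add_mulVec, kronecker_mulVec_vec, kronecker_mulVec_vec, ← vec_add,
    vec_eq_zero_iff, transpose_one, transpose_transpose, mul_one, one_mul] at hv
  have hsemi : SemiconjBy X (-M) Mᴴ := by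
    rw [SemiconjBy, mul_neg]
    exact (eq_neg_of_add_eq_zero_left hv).symm
  rw [vec_eq_zero_iff]
  refine eq_zero_of_semiconjBy_of_disjoint_spectrum hsemi (Set.disjoint_left.mpr fun μ h₁ h₂ ↦ ?_)
  rw [← star_eq_conjTranspose, spectrum.map_star] at h₁
  rw [← spectrum.neg_eq] at h₂
  have hstar : μ.re < 0 := by simpa using hM _ h₁
  have hneg : 0 < μ.re := by simpa using hM _ h₂
  exact hstar.not_gt hneg
end

section
/- Let A, G, Q, X be n×n real matrices with G, Q, X symmetric, such that A − G X is c-stable, and let Z₁ = Iₙ ⊗ (A−GX)ᵀ + (A−GX)ᵀ ⊗ Iₙ, which is then invertible. Let ε ≥ 0 and let ΔA, ΔG, ΔQ be n×n real matrices with ΔG, ΔQ symmetric and entrywise bounds |ΔA| ≤ ε|A|, |ΔG| ≤ ε|G|, |ΔQ| ≤ ε|Q|. If ΔX is the (unique) solution of the continuous Lyapunov equation (A−GX)ᵀ ΔX + ΔX (A−GX) = −ΔQ − X ΔA − ΔAᵀ X + X ΔG X, then ‖ΔX‖_max ≤ ε · ‖Z₁⁻¹‖_∞ · ‖ |X| |A|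 + |A|ᵀ |X| + |X| |G| |X| + |Q| ‖_max. -/
open Matrix
open scoped Kronecker

/-- A Sylvester operator `Y ↦ N * Y + Y * M` is injective when some polynomial annihilates `N`
and has no root among the negatives of the eigenvalues of `M`. -/
theorem eq_zero_of_mul_add_mul_eq_zero {n : ℕ} {N M Y : Matrix (Fin n) (Fin n) ℂ}
    {p : Polynomial ℂ} (hp : p ≠ 0) (hN : Polynomial.aeval N p = 0)
    (hM : ∀ μ ∈ spectrum ℂ (-M), p.eval μ ≠ 0) (h : N * Y + Y * M = 0) : Y = 0 := by
  have hc : N * Y = Y * (-M) := by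
    rw [mul_neg]; exact eq_neg_of_add_eq_zero_left h
  have hpoly : ∀ q : Polynomial ℂ, Polynomial.aeval N q * Y = Y * Polynomial.aeval (-M) q := by
    intro q
    induction q using Polynomial.induction_on' with
    | add a b ha hb => simp only [map_add, add_mul, mul_add, ha, hb]
    | monomial k a =>
      have hk : N ^ k * Y = Y * (-M) ^ k := by
        induction k with
        | zero => simp
        | succ k ih => rw [pow_succ, pow_succ, mul_assoc, hc, ← mul_assoc, ih, mul_assoc]
      rw [Polynomial.aeval_monomial, Polynomial.aeval_monomial, mul_assoc, hk,
        ← mul_assoc, ← mul_assoc, Algebra.commutes]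
  have hz : Y * Polynomial.aeval (-M) p = 0 := by rw [← hpoly, hN, zero_mul]
  have hu : IsUnit (Polynomial.aeval (-M) p) := by
    by_contra hnu
    have hsplit := IsAlgClosed.splits p
    rw [hsplit.eq_prod_roots] at hnu
    rw [map_mul, Polynomial.aeval_C] at hnu
    have hlead : IsUnit (algebraMap ℂ (Matrix (Fin n) (Fin n) ℂ) p.leadingCoeff) :=
      (IsUnit.mk0 _ (Polynomial.leadingCoeff_ne_zero.mpr hp)).map _
    have hnu' : ¬ IsUnit (Polynomial.aeval (-M)
        (Multiset.map (fun x => Polynomial.X - Polynomial.C x) p.roots).prod) :=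
      fun hh => hnu (hlead.mul hh)
    obtain ⟨k, hk, hk0⟩ := spectrum.exists_mem_of_not_isUnit_aeval_prod hnu'
    exact hM k hk hk0
  exact hu.mul_left_eq_zero.mp hz

/-- The Kronecker matrix of the Lyapunov operator of a c-stable real matrix is invertible. -/
theorem isUnit_det_lyapunov_of_stable {n : ℕ} (M : Matrix (Fin n) (Fin n) ℝ)
    (hstab : ∀ μ ∈ spectrum ℂ (M.map Complex.ofReal), μ.re < 0) :
    IsUnit ((1 : Matrix (Fin n) (Fin n) ℝ) ⊗ₖ Mᵀ +
      Mᵀ ⊗ₖ (1 : Matrix (Fin n) (Fin n) ℝ)).det := by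
  rw [isUnit_iff_ne_zero]
  intro hdet
  obtain ⟨v, hv, hv0⟩ := Matrix.exists_mulVec_eq_zero_iff.mpr hdet
  obtain ⟨Y, rfl⟩ := Matrix.vec_bijective.surjective v
  rw [add_mulVec, kronecker_mulVec_vec, kronecker_mulVec_vec, ← vec_add, vec_eq_zero_iff] at hv0
  simp only [transpose_one, mul_one, one_mul, transpose_transpose] at hv0
  apply hv
  rw [vec_eq_zero_iff]
  set Mc : Matrix (Fin n) (Fin n) ℂ := M.map Complex.ofReal with hMc
  have hc : Mcᵀ * Y.map Complex.ofReal + Y.map Complex.ofReal * Mc = 0 := by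
    have := congrArg (fun W : Matrix (Fin n) (Fin n) ℝ => Complex.ofRealHom.mapMatrix W) hv0
    simp only [map_add, map_mul, map_zero] at this
    exact this
  have hY : Y.map Complex.ofReal = 0 := by
    refine eq_zero_of_mul_add_mul_eq_zero (p := Mc.charpoly) Mc.charpoly_monic.ne_zero ?_ ?_ hc
    · rw [← Matrix.charpoly_transpose]; exact Matrix.aeval_self_charpoly _
    · intro μ hμ h0
      have h1 : μ ∈ spectrum ℂ Mc := Matrix.mem_spectrum_iff_isRoot_charpoly.mpr h0
      rw [← spectrum.neg_eq, Set.mem_neg] at hμ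
      have h2 := hstab _ h1
      have h3 := hstab _ hμ
      simp only [Complex.neg_re] at h3
      linarith
  ext i j
  have := congrFun (congrFun hY i) j
  simpa using this

theorem abs_mul_apply_le {l m n : Type*} [Fintype m] {B B' : Matrix l m ℝ} {C C' : Matrix m n ℝ}
    (hB : ∀ i j, |B i j| ≤ B' i j) (hC : ∀ i j, |C i j| ≤ C' i j) (i : l) (j : n) :
    |(B * C) i j| ≤ (B' * C') i j := by
  rw [mul_apply, mul_apply]
  refine (Finset.abs_sum_le_sum_abs _ _).trans (Finset.sum_le_sum fun k _ => ?_)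
  rw [abs_mul]
  exact mul_le_mul (hB i k) (hC k j) (abs_nonneg _) ((abs_nonneg _).trans (hB i k))

/-- First-order structured mixed condition bound for the real CARE: if `A − GX` is
c-stable (so `Z₁ = Iₙ ⊗ (A−GX)ᵀ + (A−GX)ᵀ ⊗ Iₙ` is invertible), the perturbations are
symmetric with entrywise bounds `|ΔA| ≤ ε|A|`, `|ΔG| ≤ ε|G|`, `|ΔQ| ≤ ε|Q|`, and `ΔX`
solves the Lyapunov equation
`(A−GX)ᵀ ΔX + ΔX (A−GX) = −ΔQ − X ΔA − ΔAᵀ X + X ΔG X`, then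
`‖ΔX‖_max ≤ ε ‖Z₁⁻¹‖_∞ ‖ |X||A| + |A|ᵀ|X| + |X||G||X| + |Q| ‖_max`. -/
theorem care_real_mixed_condition_bound (n : ℕ)
    (A G Q X ΔA ΔG ΔQ ΔX : Matrix (Fin n) (Fin n) ℝ)
    (hGs : G.IsSymm) (hQs : Q.IsSymm) (hXs : X.IsSymm)
    (hΔGs : ΔG.IsSymm) (hΔQs : ΔQ.IsSymm)
    (hstab : ∀ μ ∈ spectrum ℂ ((A - G * X).map (Complex.ofReal)), μ.re < 0)
    (ε : ℝ) (hε : 0 ≤ ε)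
    (hA : ∀ i j, |ΔA i j| ≤ ε * |A i j|)
    (hG : ∀ i j, |ΔG i j| ≤ ε * |G i j|)
    (hQ : ∀ i j, |ΔQ i j| ≤ ε * |Q i j|)
    (heq : (A - G * X)ᵀ * ΔX + ΔX * (A - G * X) =
      -ΔQ - X * ΔA - ΔAᵀ * X + X * ΔG * X) :
    (⨆ i, ⨆ j, |ΔX i j|) ≤
      ε * (⨆ i, ∑ j, |(((1 : Matrix (Fin n) (Fin n) ℝ) ⊗ₖ (A - G * X)ᵀ +
              (A - G * X)ᵀ ⊗ₖ (1 : Matrix (Fin n) (Fin n) ℝ))⁻¹) i j|) *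
        (⨆ i, ⨆ j, |((X.map fun a => |a|) * (A.map fun a => |a|) +
            (A.map fun a => |a|)ᵀ * (X.map fun a => |a|) +
            (X.map fun a => |a|) * (G.map fun a => |a|) * (X.map fun a => |a|) +
            Q.map fun a => |a|) i j|) := by
  set Z := (1 : Matrix (Fin n) (Fin n) ℝ) ⊗ₖ (A - G * X)ᵀ +
    (A - G * X)ᵀ ⊗ₖ (1 : Matrix (Fin n) (Fin n) ℝ) with hZ
  set B := (X.map fun a => |a|) * (A.map fun a => |a|) +
    (A.map fun a => |a|)ᵀ * (X.map fun a => |a|) +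
    (X.map fun a => |a|) * (G.map fun a => |a|) * (X.map fun a => |a|) +
    Q.map fun a => |a| with hB
  set R := -ΔQ - X * ΔA - ΔAᵀ * X + X * ΔG * X with hR
  have hZu : IsUnit Z.det := isUnit_det_lyapunov_of_stable _ hstab
  have hZX : Z *ᵥ vec ΔX = vec R := by
    rw [hZ, add_mulVec, kronecker_mulVec_vec, kronecker_mulVec_vec, ← vec_add, ← heq]
    simp
  have hsol : vec ΔX = Z⁻¹ *ᵥ vec R := by
    rw [← hZX, mulVec_mulVec, nonsing_inv_mul _ hZu, one_mulVec]
  have hRB : ∀ i j, |R i j| ≤ ε * B i j := by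
    intro i j
    have hX : ∀ i j, |X i j| ≤ (X.map fun a => |a|) i j := fun _ _ => le_rfl
    have hA' : ∀ i j, |ΔA i j| ≤ (ε • A.map fun a => |a|) i j := hA
    have hAt : ∀ i j, |ΔAᵀ i j| ≤ (ε • (A.map fun a => |a|)ᵀ) i j := fun i j => hA j i
    have hG' : ∀ i j, |ΔG i j| ≤ (ε • G.map fun a => |a|) i j := hG
    have h1 := abs_mul_apply_le hX hA' i j
    have h2 := abs_mul_apply_le hAt hX i j
    have h3 := abs_mul_apply_le (abs_mul_apply_le hX hG') hX i j
    have h4 := hQ i j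
    simp only [Matrix.mul_smul, Matrix.smul_mul, Matrix.smul_apply, smul_eq_mul] at h1 h2 h3
    simp only [hR, hB, Matrix.add_apply, Matrix.sub_apply, Matrix.neg_apply, map_apply, mul_add]
    rw [abs_le] at h1 h2 h3 h4 ⊢
    constructor <;> linarith [h1.1, h1.2, h2.1, h2.2, h3.1, h3.2, h4.1, h4.2]
  have hB0 : ∀ i j, |B i j| ≤ ⨆ i, ⨆ j, |B i j| := fun i j =>
    (le_ciSup (f := fun j => |B i j|) (Set.finite_range _).bddAbove j).trans
      (le_ciSup (f := fun i => ⨆ j, |B i j|) (Set.finite_range _).bddAbove i)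
  set b := ⨆ i, ⨆ j, |B i j|
  set z := ⨆ i, ∑ j, |Z⁻¹ i j|
  have hb : 0 ≤ b := Real.iSup_nonneg fun i => Real.iSup_nonneg fun j => abs_nonneg _
  have hz : 0 ≤ z := Real.iSup_nonneg fun i => Finset.sum_nonneg fun j _ => abs_nonneg _
  have hpos : 0 ≤ ε * z * b := by positivity
  refine Real.iSup_le (fun i => Real.iSup_le (fun j => ?_) hpos) hpos
  have hij : ΔX i j = ∑ k, Z⁻¹ (j, i) k * vec R k := congrFun hsol (j, i)
  calc |ΔX i j| ≤ ∑ k, |Z⁻¹ (j, i) k| * (ε * b) := by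
        rw [hij]
        refine (Finset.abs_sum_le_sum_abs _ _).trans (Finset.sum_le_sum fun k _ => ?_)
        rw [abs_mul]
        refine mul_le_mul_of_nonneg_left ((hRB k.2 k.1).trans ?_) (abs_nonneg _)
        exact mul_le_mul_of_nonneg_left ((le_abs_self _).trans (hB0 _ _)) hε
    _ = (∑ k, |Z⁻¹ (j, i) k|) * (ε * b) := (Finset.sum_mul _ _ _).symm
    _ ≤ z * (ε * b) := mul_le_mul_of_nonneg_right
        (le_ciSup (f := fun i => ∑ j, |Z⁻¹ i j|) (Set.finite_range _).bddAbove (j, i))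
        (mul_nonneg hε hb)
    _ = ε * z * b := by ring
end
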